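/- Let $u^\varepsilon, u^{\varepsilon,\eta} \in C(\mathbb{T}^n)$ satisfy (in the viscosity sense) $\varepsilon u^\varepsilon + H(x,Du^\varepsilon) = a(x)\Delta u^\varepsilon$ and $\varepsilon u^{\varepsilon,\eta} + H(x,Du^{\varepsilon,\eta}) = (a(x)+\eta^2)\Delta u^{\varepsilon,\eta}$, and assume the uniform Lipschitz and semiconcavity-type bound $\|Du^{\varepsilon,\eta}\|_\infty + \|\Delta u^{\varepsilon,\eta}\|_{\text{(one-sided)}} \le C$ independent of $\varepsilon,\eta$. Then $\|u^{\varepsilon,\eta} - u^\varepsilon\|_{L^\infty(\mathbb{T}^n)} \le C\varepsilon^{-1}\eta$ for a constant $C$ independent of $\varepsilon$ and $\eta$. -/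

import Mathlib

noncomputable section

def ZnPeriodic {n : ℕ} {α : Type*} (f : EuclideanSpace ℝ (Fin n) → α) : Prop :=
  ∀ (x : EuclideanSpace ℝ (Fin n)) (k : Fin n → ℤ),
    f (x + (WithLp.equiv 2 (Fin n → ℝ)).symm fun i => (k i : ℝ)) = f x

def lap {n : ℕ} (f : EuclideanSpace ℝ (Fin n) → ℝ)
    (x : EuclideanSpace ℝ (Fin n)) : ℝ :=
  ∑ i : Fin n, fderiv ℝ (fun y => fderiv ℝ f y (EuclideanSpace.single i 1)) x
    (EuclideanSpace.single i 1)

/-- viscosity subsolution of `F(x, u, Du, Δu) = 0` -/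
def IsViscSubsolution {n : ℕ}
    (F : EuclideanSpace ℝ (Fin n) → ℝ → EuclideanSpace ℝ (Fin n) → ℝ → ℝ)
    (u : EuclideanSpace ℝ (Fin n) → ℝ) : Prop :=
  ∀ φ : EuclideanSpace ℝ (Fin n) → ℝ, ContDiff ℝ 2 φ →
    ∀ x, IsLocalMax (fun y => u y - φ y) x →
      F x (u x) (gradient φ x) (lap φ x) ≤ 0

/-- viscosity supersolution of `F(x, u, Du, Δu) = 0` -/
def IsViscSupersolution {n : ℕ}
    (F : EuclideanSpace ℝ (Fin n) → ℝ → EuclideanSpace ℝ (Fin n) → ℝ → ℝ)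
    (u : EuclideanSpace ℝ (Fin n) → ℝ) : Prop :=
  ∀ φ : EuclideanSpace ℝ (Fin n) → ℝ, ContDiff ℝ 2 φ →
    ∀ x, IsLocalMin (fun y => u y - φ y) x →
      0 ≤ F x (u x) (gradient φ x) (lap φ x)

def IsViscSolution {n : ℕ}
    (F : EuclideanSpace ℝ (Fin n) → ℝ → EuclideanSpace ℝ (Fin n) → ℝ → ℝ)
    (u : EuclideanSpace ℝ (Fin n) → ℝ) : Prop :=
  IsViscSubsolution F u ∧ IsViscSupersolution F u

open Set Filter Topology

abbrev EE (n : ℕ) := EuclideanSpace ℝ (Fin n)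

/-- basis vector -/
def bv {n : ℕ} (i : Fin n) : EE n := EuclideanSpace.single i 1

def d2 {n : ℕ} (f : EE n → ℝ) (x e : EE n) : ℝ :=
  fderiv ℝ (fun y => fderiv ℝ f y e) x e

lemma lap_eq {n : ℕ} (f : EE n → ℝ) (x : EE n) : lap f x = ∑ i, d2 f x (bv i) := rfl

lemma contDiff_d1 {n : ℕ} {f : EE n → ℝ} (hf : ContDiff ℝ 2 f) (e : EE n) :
    ContDiff ℝ 1 (fun y => fderiv ℝ f y e) := by
  have : ContDiff ℝ 1 (fderiv ℝ f) := hf.fderiv_right (by norm_num)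
  exact this.clm_apply contDiff_const

lemma cd_diff {n : ℕ} {f : EE n → ℝ} (hf : ContDiff ℝ 2 f) : Differentiable ℝ f :=
  hf.differentiable (by norm_num)

lemma cd_diff1 {n : ℕ} {f : EE n → ℝ} (hf : ContDiff ℝ 2 f) (e : EE n) :
    Differentiable ℝ (fun y => fderiv ℝ f y e) :=
  (contDiff_d1 hf e).differentiable (by norm_num)

lemma line_d1 {n : ℕ} {f : EE n → ℝ} (hf : ContDiff ℝ 2 f) (x e : EE n) (s t : ℝ) :
    HasDerivAt (fun t : ℝ => f (x + (s * t) • e)) (s * fderiv ℝ f (x + (s * t) • e) e) t := by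
  have h1 : HasDerivAt (fun t : ℝ => x + (s * t) • e) (s • e) t := by
    have := (((hasDerivAt_id t).const_mul s).smul_const e).const_add x
    simpa using this
  have h2 := ((cd_diff hf) (x + (s * t) • e)).hasFDerivAt.comp_hasDerivAt t h1
  rw [map_smul, smul_eq_mul] at h2
  exact h2

lemma line_d2 {n : ℕ} {f : EE n → ℝ} (hf : ContDiff ℝ 2 f) (x e : EE n) (s t : ℝ) :
    HasDerivAt (fun t : ℝ => fderiv ℝ f (x + (s * t) • e) e) (s * d2 f (x + (s * t) • e) e) t := by
  have h1 : HasDerivAt (fun t : ℝ => x + (s * t) • e) (s • e) t := by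
    have := (((hasDerivAt_id t).const_mul s).smul_const e).const_add x
    simpa using this
  have h2 := ((cd_diff1 hf e) (x + (s * t) • e)).hasFDerivAt.comp_hasDerivAt t h1
  rw [map_smul, smul_eq_mul] at h2
  exact h2

lemma second_deriv_test {g g' : ℝ → ℝ} {c t₀ : ℝ} (h1 : ∀ t, HasDerivAt g (g' t) t)
    (h2 : HasDerivAt g' c t₀) (hm : IsLocalMax g t₀) : c ≤ 0 := by
  by_contra hc
  push Not at hc
  have hd : deriv g = g' := funext fun t => (h1 t).deriv
  have h0 : deriv g t₀ = 0 := hm.deriv_eq_zero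
  have hmin : IsLocalMin g t₀ :=
    isLocalMin_of_deriv_deriv_pos (by rw [hd, h2.deriv]; exact hc) h0 (h1 t₀).continuousAt
  have hconst : g =ᶠ[𝓝 t₀] fun _ => g t₀ := by
    filter_upwards [hm, hmin] with t a b using le_antisymm a b
  have hd0 : deriv g =ᶠ[𝓝 t₀] fun _ => 0 := by
    have := hconst.deriv
    simpa using this
  have : deriv (deriv g) t₀ = 0 := by
    rw [hd0.deriv_eq]; simp
  rw [hd, h2.deriv] at this
  linarith

lemma lap_nonpos_of_localMax {n : ℕ} {f : EE n → ℝ} (hf : ContDiff ℝ 2 f) {x : EE n}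
    (hm : IsLocalMax f x) : lap f x ≤ 0 := by
  rw [lap_eq]
  refine Finset.sum_nonpos fun i _ => ?_
  have h2 := line_d2 hf x (bv i) 1 0
  simp only [one_mul, zero_smul, add_zero, mul_zero] at h2
  refine second_deriv_test (g := fun t => f (x + (1 * t) • bv i))
    (fun t => by simpa using line_d1 hf x (bv i) 1 t) h2 ?_
  have hc : ContinuousAt (fun t : ℝ => x + (1 * t) • bv i) 0 := by fun_prop
  have hm' : IsLocalMax f (x + (1 * (0:ℝ)) • bv i) := by simpa using hm
  exact IsLocalMax.comp_continuous (g := fun t : ℝ => x + (1 * t) • bv i) hm' hc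

lemma d2_add {n : ℕ} {f g : EE n → ℝ} (hf : ContDiff ℝ 2 f) (hg : ContDiff ℝ 2 g) (x e : EE n) :
    d2 (fun y => f y + g y) x e = d2 f x e + d2 g x e := by
  unfold d2
  have : (fun y => fderiv ℝ (fun y => f y + g y) y e)
      = fun y => fderiv ℝ f y e + fderiv ℝ g y e := by
    funext y
    rw [fderiv_fun_add (cd_diff hf y) (cd_diff hg y)]; rfl
  rw [this, fderiv_fun_add (cd_diff1 hf e x) (cd_diff1 hg e x)]; rfl

lemma d2_mul {n : ℕ} {f : EE n → ℝ} (hf : ContDiff ℝ 2 f) (c : ℝ) (x e : EE n) :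
    d2 (fun y => c * f y) x e = c * d2 f x e := by
  unfold d2
  have : (fun y => fderiv ℝ (fun y => c * f y) y e) = fun y => c * fderiv ℝ f y e := by
    funext y
    rw [fderiv_const_mul (cd_diff hf y)]; rfl
  rw [this, fderiv_const_mul (cd_diff1 hf e x)]; rfl

lemma lap_add {n : ℕ} {f g : EE n → ℝ} (hf : ContDiff ℝ 2 f) (hg : ContDiff ℝ 2 g) (x : EE n) :
    lap (fun y => f y + g y) x = lap f x + lap g x := by
  simp only [lap_eq, d2_add hf hg, Finset.sum_add_distrib]

lemma lap_mul {n : ℕ} {f : EE n → ℝ} (hf : ContDiff ℝ 2 f) (c : ℝ) (x : EE n) :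
    lap (fun y => c * f y) x = c * lap f x := by
  simp only [lap_eq, d2_mul hf, Finset.mul_sum]

lemma lap_neg {n : ℕ} {f : EE n → ℝ} (hf : ContDiff ℝ 2 f) (x : EE n) :
    lap (fun y => - f y) x = - lap f x := by
  have := lap_mul hf (-1) x
  simpa using this

lemma lap_sub {n : ℕ} {f g : EE n → ℝ} (hf : ContDiff ℝ 2 f) (hg : ContDiff ℝ 2 g) (x : EE n) :
    lap (fun y => f y - g y) x = lap f x - lap g x := by
  have := lap_add hf hg.neg x
  simp only [sub_eq_add_neg]
  rw [← lap_neg hg]; exact this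

lemma grad_add {n : ℕ} {f g : EE n → ℝ} (hf : ContDiff ℝ 2 f) (hg : ContDiff ℝ 2 g) (x : EE n) :
    gradient (fun y => f y + g y) x = gradient f x + gradient g x := by
  unfold gradient
  rw [fderiv_fun_add (cd_diff hf x) (cd_diff hg x), map_add]

lemma grad_mul {n : ℕ} {f : EE n → ℝ} (hf : ContDiff ℝ 2 f) (c : ℝ) (x : EE n) :
    gradient (fun y => c * f y) x = c • gradient f x := by
  unfold gradient
  rw [fderiv_const_mul (cd_diff hf x)]; simp

lemma grad_neg {n : ℕ} (f : EE n → ℝ) (x : EE n) :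
    gradient (fun y => - f y) x = - gradient f x := by
  unfold gradient
  rw [fderiv_fun_neg, map_neg]

lemma grad_sub {n : ℕ} {f g : EE n → ℝ} (hf : ContDiff ℝ 2 f) (hg : ContDiff ℝ 2 g) (x : EE n) :
    gradient (fun y => f y - g y) x = gradient f x - gradient g x := by
  unfold gradient
  rw [fderiv_fun_sub (cd_diff hf x) (cd_diff hg x), map_sub]

lemma fderiv_affine {n : ℕ} {f : EE n → ℝ} (hf : Differentiable ℝ f) (c : EE n) (s : ℝ)
    (x : EE n) :
    fderiv ℝ (fun y => f (c + s • y)) x = s • fderiv ℝ f (c + s • x) := by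
  have h1 : HasFDerivAt (fun y : EE n => c + s • y) (s • ContinuousLinearMap.id ℝ (EE n)) x :=
    ((hasFDerivAt_id x).const_smul s).const_add c
  have h2 := (hf (c + s • x)).hasFDerivAt.comp x h1
  have h3 := h2.fderiv
  change fderiv ℝ (f ∘ fun y => c + s • y) x = _
  rw [h3]; ext v; simp

lemma grad_affine {n : ℕ} {f : EE n → ℝ} (hf : Differentiable ℝ f) (c : EE n) (s : ℝ)
    (x : EE n) :
    gradient (fun y => f (c + s • y)) x = s • gradient f (c + s • x) := by
  unfold gradient
  rw [fderiv_affine hf]; simp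

lemma d2_affine {n : ℕ} {f : EE n → ℝ} (hf : ContDiff ℝ 2 f) (c : EE n) (s : ℝ) (x e : EE n) :
    d2 (fun y => f (c + s • y)) x e = s ^ 2 * d2 f (c + s • x) e := by
  unfold d2
  have : (fun y => fderiv ℝ (fun y => f (c + s • y)) y e)
      = fun y => s * (fun z => fderiv ℝ f z e) (c + s • y) := by
    funext y
    rw [fderiv_affine (cd_diff hf)]; rfl
  have hd : Differentiable ℝ fun y => (fun z => fderiv ℝ f z e) (c + s • y) :=
    (cd_diff1 hf e).comp (by fun_prop)
  rw [this, fderiv_const_mul (hd x), fderiv_affine (cd_diff1 hf e)]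
  simp; ring

lemma lap_affine {n : ℕ} {f : EE n → ℝ} (hf : ContDiff ℝ 2 f) (c : EE n) (s : ℝ) (x : EE n) :
    lap (fun y => f (c + s • y)) x = s ^ 2 * lap f (c + s • x) := by
  simp only [lap_eq, d2_affine hf, Finset.mul_sum]

lemma contDiff_nsq {n : ℕ} : ContDiff ℝ 2 (fun y : EE n => ‖y‖ ^ 2) := contDiff_norm_sq ℝ

lemma fderiv_nsq {n : ℕ} (x e : EE n) : fderiv ℝ (fun y : EE n => ‖y‖ ^ 2) x e = 2 * inner ℝ x e := by
  have := (hasStrictFDerivAt_norm_sq x).hasFDerivAt.fderiv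
  rw [this]; simp

lemma grad_nsq {n : ℕ} (x : EE n) : gradient (fun y : EE n => ‖y‖ ^ 2) x = (2:ℝ) • x := by
  refine ext_inner_right ℝ fun e => ?_
  rw [inner_gradient_left, fderiv_nsq, real_inner_smul_left]

lemma bv_norm {n : ℕ} (i : Fin n) : ‖bv i‖ = 1 := by simp [bv]

lemma d2_nsq {n : ℕ} (x e : EE n) : d2 (fun y : EE n => ‖y‖ ^ 2) x e = 2 * ‖e‖ ^ 2 := by
  unfold d2
  simp only [fderiv_nsq]
  have h : HasFDerivAt (fun y : EE n => 2 * inner ℝ y e) ((2:ℝ) • innerSL ℝ e) x := by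
    have := ((innerSL ℝ e).hasFDerivAt (x := x)).const_mul (2:ℝ)
    refine this.congr_of_eventuallyEq (Eventually.of_forall fun y => ?_)
    simp [real_inner_comm]
  rw [h.fderiv]; simp

lemma lap_nsq {n : ℕ} (x : EE n) : lap (fun y : EE n => ‖y‖ ^ 2) x = 2 * n := by
  simp [lap_eq, d2_nsq, bv_norm, mul_comm]

lemma contDiff_cosw {n : ℕ} (ξ : EE n) (θ : ℝ) :
    ContDiff ℝ 2 (fun y : EE n => Real.cos (inner ℝ ξ y + θ)) := by
  have : ContDiff ℝ 2 (fun y : EE n => inner ℝ ξ y + θ) :=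
    ((innerSL ℝ ξ).contDiff).add contDiff_const
  exact Real.contDiff_cos.comp this

lemma d2_cosw {n : ℕ} (ξ : EE n) (θ : ℝ) (x e : EE n) :
    d2 (fun y : EE n => Real.cos (inner ℝ ξ y + θ)) x e
      = - (inner ℝ ξ e) ^ 2 * Real.cos (inner ℝ ξ x + θ) := by
  have hl : ∀ y, HasFDerivAt (fun y : EE n => inner ℝ ξ y + θ) (innerSL ℝ ξ) y := fun y =>
    ((innerSL ℝ ξ).hasFDerivAt (x := y)).add_const θ
  unfold d2
  have h1 : (fun y => fderiv ℝ (fun y : EE n => Real.cos (inner ℝ ξ y + θ)) y e)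
      = fun y => (- inner ℝ ξ e) * Real.sin (inner ℝ ξ y + θ) := by
    funext y
    rw [((hl y).cos).fderiv]; simp; ring
  rw [h1, (((hl x).sin).const_mul _).fderiv]; simp; ring

lemma lap_cosw {n : ℕ} (ξ : EE n) (θ : ℝ) (x : EE n) :
    lap (fun y : EE n => Real.cos (inner ℝ ξ y + θ)) x
      = - ‖ξ‖ ^ 2 * Real.cos (inner ℝ ξ x + θ) := by
  simp only [lap_eq, d2_cosw, ← Finset.sum_mul]
  congr 1
  rw [EuclideanSpace.norm_sq_eq]
  simp [bv, EuclideanSpace.inner_single_right]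

lemma grad_cont {n : ℕ} {f : EE n → ℝ} (hf : ContDiff ℝ 2 f) : Continuous (gradient f) := by
  unfold gradient
  exact (InnerProductSpace.toDual ℝ (EE n)).symm.continuous.comp (hf.continuous_fderiv (by norm_num))

lemma lap_cont {n : ℕ} {f : EE n → ℝ} (hf : ContDiff ℝ 2 f) : Continuous (lap f) := by
  unfold lap
  refine continuous_finsetSum _ fun i _ => ?_
  exact ((contDiff_d1 hf _).continuous_fderiv (by norm_num)).clm_apply continuous_const

/-- integer lattice vector -/
def zv {n : ℕ} (k : Fin n → ℤ) : EE n := (WithLp.equiv 2 (Fin n → ℝ)).symm fun i => (k i : ℝ)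

lemma grad_per {n : ℕ} {f : EE n → ℝ} (hp : ZnPeriodic f) : ZnPeriodic (gradient f) := by
  intro x k
  unfold gradient
  rw [← fderiv_comp_add_right]
  congr 2
  funext y; exact hp y k

lemma lap_per {n : ℕ} {f : EE n → ℝ} (hp : ZnPeriodic f) : ZnPeriodic (lap f) := by
  intro x k
  unfold lap
  refine Finset.sum_congr rfl fun i _ => ?_
  rw [← fderiv_comp_add_right]
  congr 2
  funext y
  rw [← fderiv_comp_add_right]
  congr 2
  funext y; exact hp y k

lemma per_cube (n : ℕ) : ∃ K : Set (EE n), IsCompact K ∧ K.Nonempty ∧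
    ∀ x : EE n, ∃ k : Fin n → ℤ, x + zv k ∈ K := by
  refine ⟨(WithLp.toLp 2) '' (Set.pi univ fun _ : Fin n => Icc (0:ℝ) 1), ?_, ?_, ?_⟩
  · exact (isCompact_univ_pi fun _ => isCompact_Icc).image (PiLp.continuous_toLp 2 _)
  · refine ⟨WithLp.toLp 2 0, 0, ?_, rfl⟩
    intro i _
    simp
  · intro x
    refine ⟨fun i => - ⌊x i⌋, WithLp.ofLp (x + zv fun i => - ⌊x i⌋), ?_, rfl⟩
    intro i _
    have h : (x + zv fun i => - ⌊x i⌋) i = Int.fract (x i) := by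
      simp [zv, Int.fract, sub_eq_add_neg]
    change (x + zv fun i => - ⌊x i⌋) i ∈ Icc (0:ℝ) 1
    rw [h]
    exact ⟨Int.fract_nonneg _, (Int.fract_lt_one _).le⟩

lemma per_max_prod {n : ℕ} {Y : Type*} [TopologicalSpace Y] {S : Set Y} (hS : IsCompact S)
    (hSn : S.Nonempty) {G : EE n → Y → ℝ} (hG : Continuous fun q : EE n × Y => G q.1 q.2)
    (hp : ∀ y, ZnPeriodic fun x => G x y) :
    ∃ x₀, ∃ y₀ ∈ S, ∀ x, ∀ y ∈ S, G x y ≤ G x₀ y₀ := by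
  obtain ⟨K, hK, hKn, hKx⟩ := per_cube n
  obtain ⟨⟨x₀, y₀⟩, hm, hmax⟩ := (hK.prod hS).exists_isMaxOn (hKn.prod hSn) hG.continuousOn
  refine ⟨x₀, y₀, hm.2, fun x y hy => ?_⟩
  obtain ⟨k, hk⟩ := hKx x
  have := hmax (show (x + zv k, y) ∈ K ×ˢ S from ⟨hk, hy⟩)
  have h2 : G (x + zv k) y = G x y := hp y x k
  simpa [h2] using this

lemma per_max {n : ℕ} {f : EE n → ℝ} (hf : Continuous f) (hp : ZnPeriodic f) :
    ∃ x₀, ∀ x, f x ≤ f x₀ := by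
  obtain ⟨x₀, _, _, h⟩ := per_max_prod (Y := Unit) (S := univ) isCompact_univ ⟨(), trivial⟩
    (G := fun x _ => f x) (hf.comp continuous_fst) (fun _ => hp)
  exact ⟨x₀, fun x => h x () trivial⟩

lemma per_bdd {n : ℕ} {F : Type*} [SeminormedAddCommGroup F] {f : EE n → F} (hf : Continuous f)
    (hp : ZnPeriodic f) : ∃ M, 0 ≤ M ∧ ∀ x, ‖f x‖ ≤ M := by
  obtain ⟨x₀, h⟩ := per_max (f := fun x => ‖f x‖) hf.norm (fun x k => by
    have := hp x k
    simp only [this])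
  exact ⟨‖f x₀‖, norm_nonneg _, h⟩

lemma per_bdd_ball {n : ℕ} {G : EE n → EE n → ℝ} (hG : Continuous fun q : EE n × EE n => G q.1 q.2)
    (hp : ∀ y, ZnPeriodic fun x => G x y) (R : ℝ) :
    ∃ M, 0 ≤ M ∧ ∀ x p, ‖p‖ ≤ R → |G x p| ≤ M := by
  by_cases hR : 0 ≤ R
  · obtain ⟨x₀, y₀, _, h⟩ := per_max_prod (Y := EE n) (S := Metric.closedBall 0 R)
      (isCompact_closedBall _ _) ⟨0, by simpa⟩ (G := fun x y => |G x y|) hG.abs (fun y x k => by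
        have := hp y x k
        simp only at this
        simp only [this])
    exact ⟨_, abs_nonneg _, fun x p hpR => h x p (by simpa using hpR)⟩
  · exact ⟨0, le_rfl, fun x p hpR => absurd ((norm_nonneg p).trans hpR) hR⟩

lemma per_unif {n : ℕ} {G : EE n → EE n → ℝ} (hG : Continuous fun q : EE n × EE n => G q.1 q.2)
    (hp : ∀ y, ZnPeriodic fun x => G x y) (R θ : ℝ) (hθ : 0 < θ) :
    ∃ ρ > 0, ∀ x p q, ‖p‖ ≤ R → ‖q‖ ≤ R → ‖p - q‖ ≤ ρ → |G x p - G x q| ≤ θ := by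
  obtain ⟨K, hK, hKn, hKx⟩ := per_cube n
  have hu := (hK.prod (isCompact_closedBall (0 : EE n) R)).uniformContinuousOn_of_continuous
    hG.continuousOn
  rw [Metric.uniformContinuousOn_iff] at hu
  obtain ⟨ρ, hρ, h⟩ := hu θ hθ
  refine ⟨ρ / 2, by positivity, fun x p q hpR hqR hpq => ?_⟩
  obtain ⟨k, hk⟩ := hKx x
  have := h (x + zv k, p) ⟨hk, by simpa using hpR⟩ (x + zv k, q) ⟨hk, by simpa using hqR⟩ (by
    rw [Prod.dist_eq]
    simp only [dist_self, dist_eq_norm]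
    rw [max_eq_right (norm_nonneg _)]
    linarith)
  have h1 : G (x + zv k) p = G x p := hp p x k
  have h2 : G (x + zv k) q = G x q := hp q x k
  simp only [h1, h2, Real.dist_eq] at this
  exact this.le

/-- Density of trigonometric polynomials. -/
lemma trig_dense {n : ℕ} {f : EE n → ℝ} (hf : Continuous f) (hp : ZnPeriodic f) (κ : ℝ)
    (hκ : 0 < κ) : ∃ (s : Finset (Fin n → ℤ)) (A θ : (Fin n → ℤ) → ℝ),
      ∀ x, |(∑ k ∈ s, A k * Real.cos (inner ℝ ((2 * Real.pi) • zv k) x + θ k)) - f x| ≤ κ := by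
  classical
  let π : EE n → UnitAddTorus (Fin n) := fun x i => ((x i : ℝ) : UnitAddCircle)
  have hπ : IsOpenQuotientMap π := by
    have h1 : IsOpenQuotientMap (Pi.map fun (i : Fin n) (t : ℝ) => (t : UnitAddCircle)) :=
      IsOpenQuotientMap.piMap fun _ => QuotientAddGroup.isOpenQuotientMap_mk
    exact h1.comp (EuclideanSpace.equiv (Fin n) ℝ).toHomeomorph.isOpenQuotientMap
  have hfac : ∀ x y, π x = π y → f x = f y := by
    intro x y hxy
    have : ∀ i, ∃ m : ℤ, y i + m = x i := by
      intro i
      have h := congrFun hxy i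
      simp only [π] at h
      have h0 : ((x i - y i : ℝ) : UnitAddCircle) = 0 := by
        rw [AddCircle.coe_sub, h, sub_self]
      obtain ⟨m, hm⟩ := (AddCircle.coe_eq_zero_iff (p := (1:ℝ))).1 h0
      refine ⟨m, ?_⟩
      simp only [zsmul_eq_mul, mul_one] at hm
      linarith
    choose m hm using this
    have hx : x = y + zv m := by
      ext i; simp [zv, hm]
    rw [hx]; exact hp y m
  let F : C(UnitAddTorus (Fin n), ℂ) :=
    ⟨fun z => ((f (Function.surjInv hπ.surjective z) : ℝ) : ℂ), by
      rw [← hπ.continuous_comp_iff]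
      have : ((fun z => ((f (Function.surjInv hπ.surjective z) : ℝ) : ℂ)) ∘ π)
        = fun x => ((f x : ℝ) : ℂ) := by
        funext x
        simp only [Function.comp]
        rw [hfac _ x (Function.surjInv_eq hπ.surjective (π x))]
      rw [this]
      exact Complex.continuous_ofReal.comp hf⟩
  have hF : ∀ x, F (π x) = ((f x : ℝ) : ℂ) := by
    intro x
    change ((f (Function.surjInv hπ.surjective (π x)) : ℝ) : ℂ) = _
    rw [hfac _ x (Function.surjInv_eq hπ.surjective (π x))]
  have hmem : F ∈ (Submodule.span ℂ (range <| UnitAddTorus.mFourier (d := Fin n))).topologicalClosure := by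
    rw [UnitAddTorus.span_mFourier_closure_eq_top]; trivial
  obtain ⟨P, hP, hPF⟩ := Metric.mem_closure_iff.1 hmem κ hκ
  obtain ⟨c, hc⟩ := (Finsupp.mem_span_range_iff_exists_finsupp).1 hP
  refine ⟨c.support, fun k => ‖c k‖, fun k => Complex.arg (c k), fun x => ?_⟩
  have hmf : ∀ k, UnitAddTorus.mFourier k (π x)
      = Complex.exp ((inner ℝ ((2 * Real.pi) • zv k) x : ℝ) * Complex.I) := by
    intro k
    simp only [UnitAddTorus.mFourier, ContinuousMap.coe_mk, π, fourier_coe_apply]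
    rw [← Complex.exp_sum]
    congr 1
    rw [real_inner_smul_left, PiLp.inner_apply]
    simp only [zv]
    push_cast
    simp [Finset.mul_sum, Finset.sum_mul]
    refine Finset.sum_congr rfl fun i _ => ?_
    ring
  have hre : (P (π x)).re
      = ∑ k ∈ c.support, ‖c k‖ * Real.cos (inner ℝ ((2 * Real.pi) • zv k) x + Complex.arg (c k)) := by
    rw [← hc, Finsupp.sum, ContinuousMap.sum_apply, Complex.re_sum]
    refine Finset.sum_congr rfl fun k _ => ?_
    rw [ContinuousMap.smul_apply, hmf, smul_eq_mul]
    conv_lhs => rw [← Complex.norm_mul_exp_arg_mul_I (c k)]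
    rw [mul_assoc, ← Complex.exp_add, ← add_mul, ← Complex.ofReal_add, Complex.re_ofReal_mul,
      Complex.exp_ofReal_mul_I_re, add_comm]
  rw [← hre]
  have h1 : ‖P (π x) - F (π x)‖ ≤ κ := by
    rw [← dist_eq_norm, dist_comm]
    exact (ContinuousMap.dist_apply_le_dist _).trans hPF.le
  rw [hF] at h1
  have h2 := (Complex.abs_re_le_norm _).trans h1
  simpa using h2

lemma per_cosw {n : ℕ} (k : Fin n → ℤ) (θ : ℝ) :
    ZnPeriodic (fun x : EE n => Real.cos (inner ℝ ((2 * Real.pi) • zv k) x + θ)) := by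
  intro x m
  have : inner ℝ ((2 * Real.pi) • zv k) (x + zv m) + θ
      = inner ℝ ((2 * Real.pi) • zv k) x + θ + ((∑ i, m i * k i : ℤ) : ℝ) * (2 * Real.pi) := by
    rw [inner_add_right]
    have : inner ℝ ((2 * Real.pi) • zv k) (zv m) = ((∑ i, m i * k i : ℤ) : ℝ) * (2 * Real.pi) := by
      rw [real_inner_smul_left, PiLp.inner_apply]
      simp [zv, mul_comm]
    rw [this]; ring
  change Real.cos (inner ℝ ((2 * Real.pi) • zv k) (x + zv m) + θ) = _
  rw [this, Real.cos_add_int_mul_two_pi]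

lemma lap_sum {n : ℕ} {ι : Type*} (s : Finset ι) {f : ι → EE n → ℝ} (hf : ∀ i, ContDiff ℝ 2 (f i))
    (x : EE n) : lap (fun y => ∑ i ∈ s, f i y) x = ∑ i ∈ s, lap (f i) x := by
  classical
  induction s using Finset.induction_on with
  | empty => simp [lap]
  | insert a s ha ih =>
    simp only [Finset.sum_insert ha]
    rw [lap_add (hf a) (ContDiff.sum fun i _ => hf i), ih]

/-- approximate resolvent; with `μ = 0` this is density of smooth functions. -/
lemma approx_resolvent {n : ℕ} {f : EE n → ℝ} (hf : Continuous f) (hp : ZnPeriodic f) (κ : ℝ)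
    (hκ : 0 < κ) (μ : ℝ) (hμ : 0 ≤ μ) : ∃ w : EE n → ℝ, ContDiff ℝ 2 w ∧ ZnPeriodic w ∧
      ∀ x, |w x - μ * lap w x - f x| ≤ κ := by
  obtain ⟨s, A, θ, h⟩ := trig_dense hf hp κ hκ
  let m : (Fin n → ℤ) → ℝ := fun k => 1 + μ * ‖(2 * Real.pi) • zv k‖ ^ 2
  have hm : ∀ k, 0 < m k := fun k => by positivity
  let g : (Fin n → ℤ) → EE n → ℝ := fun k x =>
    (A k / m k) * Real.cos (inner ℝ ((2 * Real.pi) • zv k) x + θ k)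
  have hg : ∀ k, ContDiff ℝ 2 (g k) := fun k => contDiff_const.mul (contDiff_cosw _ _)
  refine ⟨fun x => ∑ k ∈ s, g k x, ContDiff.sum fun k _ => hg k, fun x m => ?_, fun x => ?_⟩
  · refine Finset.sum_congr rfl fun k _ => ?_
    have := per_cosw k (θ k) x m
    simp only at this
    simp only [g, this]
  · rw [lap_sum s hg]
    convert h x using 3
    rw [Finset.mul_sum, ← Finset.sum_sub_distrib]
    refine Finset.sum_congr rfl fun k _ => ?_
    simp only [g]
    rw [lap_mul (contDiff_cosw _ _), lap_cosw]
    have := (hm k).ne'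
    field_simp
    simp only [m]; ring

lemma landau_aux {n : ℕ} {f : EE n → ℝ} (hf : ContDiff ℝ 2 f) (hp : ZnPeriodic f) {A B β d : ℝ}
    (hA : ∀ x, |f x| ≤ A) (hB : ∀ x, |lap f x| ≤ B) (hβ : B < β) (hd : 0 < d) (i : Fin n)
    (x : EE n) : fderiv ℝ f x (bv i) ≤ A / d + β * d / 2 := by
  set α : ℝ := 2 * A / d + β * d with hα
  have hαd : α * d - β * d ^ 2 = 2 * A := by rw [hα]; field_simp; ring
  let G : EE n → ℝ → ℝ := fun x t =>
    f (x + (1 * t) • bv i) - f (x + (-1 * t) • bv i) - (α * t - β * t ^ 2)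
  have hfc : Continuous f := hf.continuous
  have hGc : Continuous fun q : EE n × ℝ => G q.1 q.2 := by
    simp only [G]; fun_prop
  have hGp : ∀ t, ZnPeriodic fun x => G x t := by
    intro t x k
    have h1 := hp (x + (1 * t) • bv i) k
    have h2 := hp (x + (-1 * t) • bv i) k
    simp only [G]
    rw [add_right_comm, h1, add_right_comm x _ ((-1 * t) • bv i), h2]
  obtain ⟨x₀, t₀, ht₀, hmax⟩ := per_max_prod (S := Icc 0 d) isCompact_Icc ⟨0, by simp [hd.le]⟩ hGc hGp
  have hle : G x₀ t₀ ≤ 0 := by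
    by_cases h0 : t₀ = 0
    · simp [G, h0]
    by_cases h1 : t₀ = d
    · simp only [G, h1, hαd]
      have := abs_le.1 (hA (x₀ + (1 * d) • bv i))
      have := abs_le.1 (hA (x₀ + (-1 * d) • bv i))
      linarith
    exfalso
    have htI : t₀ ∈ Ioo 0 d := ⟨lt_of_le_of_ne ht₀.1 (Ne.symm h0), lt_of_le_of_ne ht₀.2 h1⟩
    set X := x₀ + (1 * t₀) • bv i with hX
    set Y := x₀ + (-1 * t₀) • bv i with hY
    have hii : d2 f X (bv i) - d2 f Y (bv i) ≤ -2 * β := by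
      have hm : IsLocalMax (fun t => G x₀ t) t₀ := by
        filter_upwards [Ioo_mem_nhds htI.1 htI.2] with t ht
        exact hmax x₀ t ⟨ht.1.le, ht.2.le⟩
      have hd1 : ∀ t, HasDerivAt (fun t => G x₀ t)
          (1 * fderiv ℝ f (x₀ + (1 * t) • bv i) (bv i)
            - (-1) * fderiv ℝ f (x₀ + (-1 * t) • bv i) (bv i) - (α - β * (2 * t))) t := by
        intro t
        refine ((line_d1 hf x₀ (bv i) 1 t).sub (line_d1 hf x₀ (bv i) (-1) t)).sub ?_
        have h1 := (hasDerivAt_id t).const_mul α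
        have h2 := ((hasDerivAt_id t).pow 2).const_mul β
        have := h1.sub h2
        simp only [id, Nat.cast_ofNat, Nat.add_one_sub_one, pow_one, mul_one] at this
        exact this
      have hd2 : HasDerivAt (fun t => 1 * fderiv ℝ f (x₀ + (1 * t) • bv i) (bv i)
            - (-1) * fderiv ℝ f (x₀ + (-1 * t) • bv i) (bv i) - (α - β * (2 * t)))
          (1 * (1 * d2 f X (bv i)) - (-1) * (-1 * d2 f Y (bv i)) - (0 - β * 2)) t₀ := by
        refine (((line_d2 hf x₀ (bv i) 1 t₀).const_mul 1).sub
          ((line_d2 hf x₀ (bv i) (-1) t₀).const_mul (-1))).sub ?_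
        have h2 := (((hasDerivAt_id t₀).const_mul 2).const_mul β).const_sub α
        simpa using h2
      have := second_deriv_test hd1 hd2 hm
      linarith
    have hjj : ∀ j, d2 f X (bv j) - d2 f Y (bv j) ≤ 0 := by
      intro j
      have hm : IsLocalMax (fun s : ℝ => f (X + (1 * s) • bv j) - f (Y + (1 * s) • bv j)) 0 := by
        refine Eventually.of_forall fun s => ?_
        have := hmax (x₀ + (1 * s) • bv j) t₀ ht₀
        simp only [G] at this
        rw [add_right_comm, add_right_comm x₀ _ ((-1 * t₀) • bv i), ← hX, ← hY] at this
        simp only [mul_zero, zero_smul, add_zero]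
        linarith
      have hd2 := (line_d2 hf X (bv j) 1 0).sub (line_d2 hf Y (bv j) 1 0)
      simp only [mul_zero, zero_smul, add_zero, one_mul] at hd2
      refine second_deriv_test (fun t => ?_) hd2 hm
      have := (line_d1 hf X (bv j) 1 t).sub (line_d1 hf Y (bv j) 1 t)
      simp only [one_mul] at this ⊢
      exact this
    have hsum : lap f X - lap f Y ≤ -2 * β := by
      rw [lap_eq, lap_eq, ← Finset.sum_sub_distrib, ← Finset.add_sum_erase _ _ (Finset.mem_univ i)]
      have := Finset.sum_nonpos (s := Finset.univ.erase i) fun j _ => hjj j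
      linarith
    have h1 := abs_le.1 (hB X)
    have h2 := abs_le.1 (hB Y)
    linarith
  have hx : ∀ t ∈ Ioc 0 d, G x t ≤ 0 := fun t ht => (hmax x t ⟨ht.1.le, ht.2⟩).trans hle
  have hder : HasDerivAt (fun t => G x t) (2 * fderiv ℝ f x (bv i) - α) 0 := by
    have h1 := (hasDerivAt_id (0:ℝ)).const_mul α
    have h2 := ((hasDerivAt_id (0:ℝ)).pow 2).const_mul β
    have h3 := ((line_d1 hf x (bv i) 1 0).sub (line_d1 hf x (bv i) (-1) 0)).sub (h1.sub h2)
    have h4 : 1 * fderiv ℝ f (x + (1 * (0:ℝ)) • bv i) (bv i)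
       - -1 * fderiv ℝ f (x + (-1 * (0:ℝ)) • bv i) (bv i)
       - (α * 1 - β * (((2:ℕ):ℝ) * (id (0:ℝ)) ^ (2 - 1) * 1)) = 2 * fderiv ℝ f x (bv i) - α := by
      simp; ring
    rw [h4] at h3
    exact h3
  have hle2 : 2 * fderiv ℝ f x (bv i) - α ≤ 0 := by
    have ht := (hasDerivAt_iff_tendsto_slope.1 hder).mono_left
      (nhdsWithin_mono (0:ℝ) (show Ioi (0:ℝ) ⊆ {0}ᶜ from fun t ht => ne_of_gt ht))
    refine le_of_tendsto ht ?_
    filter_upwards [Ioc_mem_nhdsGT hd] with t ht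
    have h0 : G x 0 = 0 := by simp [G]
    rw [slope_def_field, h0]
    exact div_nonpos_of_nonpos_of_nonneg (by simpa using hx t ht) (by simpa using ht.1.le)
  have : A / d + β * d / 2 = α / 2 := by rw [hα]; ring
  linarith

lemma landau {n : ℕ} {f : EE n → ℝ} (hf : ContDiff ℝ 2 f) (hp : ZnPeriodic f) {A B β d : ℝ}
    (hA : ∀ x, |f x| ≤ A) (hB : ∀ x, |lap f x| ≤ B) (hβ : B < β) (hd : 0 < d)
    (x : EE n) : ‖gradient f x‖ ≤ n * (A / d + β * d / 2) := by
  have h1 : ∀ i, |gradient f x i| ≤ A / d + β * d / 2 := by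
    intro i
    have hi : gradient f x i = fderiv ℝ f x (bv i) := by
      rw [← inner_gradient_left, bv, EuclideanSpace.inner_single_right]; simp
    rw [hi, abs_le]
    constructor
    · have := landau_aux hf.neg (fun x k => by
        have := hp x k
        simp only [this]) (A := A) (B := B) (fun x => by simpa using hA x) (fun x => by
        have := lap_neg hf x
        change |lap (fun y => - f y) x| ≤ B
        rw [this, abs_neg]; exact hB x) hβ hd i x
      have h2 : fderiv ℝ (fun y => -f y) x (bv i) = - fderiv ℝ f x (bv i) := by
        rw [fderiv_fun_neg]; rfl
      rw [h2] at this
      linarith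
    · exact landau_aux hf hp hA hB hβ hd i x
  have h2 := (EuclideanSpace.basisFun (Fin n) ℝ).sum_repr (gradient f x)
  rw [← h2]
  refine (norm_sum_le _ _).trans ?_
  calc _ ≤ ∑ i : Fin n, (A / d + β * d / 2) := by
        refine Finset.sum_le_sum fun i _ => ?_
        rw [norm_smul, (EuclideanSpace.basisFun (Fin n) ℝ).orthonormal.1 i, mul_one]
        simpa using h1 i
    _ = _ := by simp; ring

lemma res_bound {n : ℕ} {v w : EE n → ℝ} {K m θ : ℝ} (hv : Continuous v) (hvp : ZnPeriodic v)
    (hw : ContDiff ℝ 2 w) (hwp : ZnPeriodic w) (hm : 0 < m)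
    (hK : ∀ φ : EE n → ℝ, ContDiff ℝ 2 φ → ∀ x, IsLocalMin (fun y => v y - φ y) x → lap φ x ≤ K)
    (hres : ∀ x, |w x - m * lap w x - v x| ≤ m * θ) (x : EE n) :
    w x - v x ≤ m * (K + θ) ∧ lap w x ≤ K + 2 * θ := by
  obtain ⟨x₀, hx₀⟩ := per_max (f := fun x => w x - v x) (hw.continuous.sub hv) (fun x k => by
    have h1 := hwp x k
    have h2 := hvp x k
    simp only [h1, h2])
  have hmin : IsLocalMin (fun y => v y - w y) x₀ := Eventually.of_forall fun y => by
    have := hx₀ y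
    linarith
  have h1 := hK w hw x₀ hmin
  have h2 := (abs_le.1 (hres x₀)).2
  have h3 : m * lap w x₀ ≤ m * K := by gcongr
  have h4 : w x - v x ≤ m * (K + θ) := by
    have := hx₀ x
    linarith
  refine ⟨h4, ?_⟩
  have h5 := (abs_le.1 (hres x)).1
  have h6 : m * lap w x ≤ m * (K + 2 * θ) := by linarith
  exact le_of_mul_le_mul_left h6 hm

lemma res_step {n : ℕ} {v w z g : EE n → ℝ} {m θ κ : ℝ} {b : EE n → EE n → ℝ}
    (hv : Continuous v) (hvp : ZnPeriodic v)
    (hw : ContDiff ℝ 2 w) (hwp : ZnPeriodic w) (hz : ContDiff ℝ 2 z) (hzp : ZnPeriodic z)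
    (hm : 0 < m) (hθ : θ ≤ κ)
    (hb : ∀ φ : EE n → ℝ, ContDiff ℝ 2 φ → ∀ x, IsLocalMin (fun y => v y - φ y) x →
      lap φ x ≤ b x (gradient φ x))
    (hres : ∀ x, |w x - m * lap w x - v x| ≤ m * θ)
    (hzg : ∀ x, |z x - g x| ≤ κ) (hzl : ∀ x, m * |lap z x| ≤ κ)
    (hclose : ∀ x, b x (gradient w x - m • gradient z x) ≤ g x + κ) (x : EE n) :
    lap w x ≤ g x + 6 * κ := by
  have hφ : ContDiff ℝ 2 (fun y => w y - m * z y) := hw.sub (contDiff_const.mul hz)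
  obtain ⟨x₀, hx₀⟩ := per_max (f := fun x => w x - m * z x - v x) (hφ.continuous.sub hv) (fun x k => by
    have h1 := hwp x k
    have h2 := hvp x k
    have h3 := hzp x k
    simp only [h1, h2, h3])
  have hmin : IsLocalMin (fun y => v y - (w y - m * z y)) x₀ := Eventually.of_forall fun y => by
    have := hx₀ y
    linarith
  have h1 := hb _ hφ x₀ hmin
  rw [lap_sub hw (contDiff_const.mul hz), lap_mul hz, grad_sub hw (contDiff_const.mul hz),
    grad_mul hz] at h1
  have h1' := h1.trans (hclose x₀)
  have h2 := (abs_le.1 (hres x₀)).2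
  have hzl0 : m * lap z x₀ ≤ κ := (mul_le_mul_of_nonneg_left (le_abs_self _) hm.le).trans (hzl x₀)
  have hz0 := abs_le.1 (hzg x₀)
  have hz1 := abs_le.1 (hzg x)
  have h3 : m * lap w x₀ ≤ m * (z x₀ + 3 * κ) := by gcongr; linarith
  have h5 := (abs_le.1 (hres x)).1
  have hx := hx₀ x
  have h7 : m * θ ≤ m * κ := by gcongr
  have h6 : m * lap w x ≤ m * (z x + 5 * κ) := by linarith
  have := le_of_mul_le_mul_left h6 hm
  linarith

lemma neg_visc {n : ℕ} {v φ : EE n → ℝ} {x : EE n} (h : IsLocalMin (fun y => - v y - φ y) x) :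
    IsLocalMax (fun y => v y - (fun y => - φ y) y) x := by
  have := h.neg
  refine this.congr (Eventually.of_forall fun y => ?_)
  simp; ring

lemma per_neg {n : ℕ} {v : EE n → ℝ} (h : ZnPeriodic v) : ZnPeriodic fun y => - v y := by
  intro x k
  have := h x k
  simp only [this]

lemma neg_bound {n : ℕ} {v : EE n → ℝ} {b : EE n → EE n → ℝ}
    (hb : ∀ φ : EE n → ℝ, ContDiff ℝ 2 φ → ∀ x, IsLocalMax (fun y => v y - φ y) x →
      b x (gradient φ x) ≤ lap φ x) :
    ∀ φ : EE n → ℝ, ContDiff ℝ 2 φ → ∀ x, IsLocalMin (fun y => - v y - φ y) x →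
      lap φ x ≤ - b x (- gradient φ x) := by
  intro φ hφ x hx
  have := hb _ hφ.neg x (neg_visc hx)
  rw [grad_neg, lap_neg hφ] at this
  linarith

lemma neg_res {n : ℕ} {v w : EE n → ℝ} {m c : ℝ} (hw : ContDiff ℝ 2 w)
    (h : ∀ x, |w x - m * lap w x - v x| ≤ c) (x : EE n) :
    |(fun y => - w y) x - m * lap (fun y => - w y) x - (fun y => - v y) x| ≤ c := by
  rw [lap_neg hw]
  have := h x
  rw [← abs_neg] at this
  convert this using 2
  simp; ring

lemma regularize {n : ℕ} {v : EE n → ℝ} {b : EE n → EE n → ℝ} {K κ : ℝ}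
    (hv : Continuous v) (hvp : ZnPeriodic v) (hK : 0 ≤ K) (hκ : 0 < κ)
    (hbc : Continuous fun q : EE n × EE n => b q.1 q.2) (hbp : ∀ p, ZnPeriodic fun x => b x p)
    (hb1 : ∀ φ : EE n → ℝ, ContDiff ℝ 2 φ → ∀ x, IsLocalMin (fun y => v y - φ y) x →
      lap φ x ≤ b x (gradient φ x))
    (hb2 : ∀ φ : EE n → ℝ, ContDiff ℝ 2 φ → ∀ x, IsLocalMax (fun y => v y - φ y) x →
      b x (gradient φ x) ≤ lap φ x)
    (hK1 : ∀ φ : EE n → ℝ, ContDiff ℝ 2 φ → ∀ x, IsLocalMin (fun y => v y - φ y) x → lap φ x ≤ K)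
    (hK2 : ∀ φ : EE n → ℝ, ContDiff ℝ 2 φ → ∀ x, IsLocalMax (fun y => v y - φ y) x → -K ≤ lap φ x) :
    ∃ w : EE n → ℝ, ContDiff ℝ 2 w ∧ ZnPeriodic w ∧ (∀ x, |w x - v x| ≤ κ) ∧
      ∀ x, |lap w x - b x (gradient w x)| ≤ κ := by
  obtain ⟨Mv, hMv0, hMv⟩ := per_bdd hv hvp
  have hK2' := neg_bound (b := fun _ _ => -K) hK2
  have hb2' := neg_bound hb2
  -- basic bounds of resolvents
  have key : ∀ (w : EE n → ℝ) (m θ : ℝ), ContDiff ℝ 2 w → ZnPeriodic w → 0 < m → θ ≤ 1 →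
      (∀ x, |w x - m * lap w x - v x| ≤ m * θ) →
      (∀ x, |w x - v x| ≤ m * (K + 1)) ∧ ∀ x, |lap w x| ≤ K + 2 := by
    intro w m θ hw hwp hm hθ hres
    have hle : m * (K + θ) ≤ m * (K + 1) := by gcongr
    have h1 := res_bound hv hvp hw hwp hm hK1 hres
    have h2 := res_bound (v := fun y => - v y) hv.neg (per_neg hvp) hw.neg (per_neg hwp) hm (K := K)
      (fun φ hφ x hx => by simpa using hK2' φ hφ x hx) (neg_res hw hres)
    constructor
    · intro x
      have h2x := (h2 x).1
      exact abs_le.2 ⟨by linarith, by linarith [(h1 x).1]⟩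
    · intro x
      have h2x := (h2 x).2
      rw [lap_neg hw] at h2x
      exact abs_le.2 ⟨by linarith, by linarith [(h1 x).2]⟩
  set R : ℝ := n * ((Mv + K + 1) / 1 + (K + 3) * 1 / 2) with hR
  have gradR : ∀ (w : EE n → ℝ) (m θ : ℝ), ContDiff ℝ 2 w → ZnPeriodic w → 0 < m → m ≤ 1 → θ ≤ 1 →
      (∀ x, |w x - m * lap w x - v x| ≤ m * θ) → ∀ x, ‖gradient w x‖ ≤ R := by
    intro w m θ hw hwp hm hm1 hθ hres x
    obtain ⟨h1, h2⟩ := key w m θ hw hwp hm hθ hres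
    refine landau hw hwp (fun x => ?_) h2 (by linarith) one_pos x
    have h3 := abs_le.1 (h1 x)
    have h4 := abs_le.1 (hMv x)
    have h5 : m * (K + 1) ≤ 1 * (K + 1) := by gcongr
    exact abs_le.2 ⟨by linarith, by linarith⟩
  obtain ⟨ρ₀, hρ₀, hunif⟩ := per_unif hbc hbp (R + 1) (κ / 10) (by positivity)
  set ρ := min ρ₀ 1 with hρdef
  have hρ : 0 < ρ := lt_min hρ₀ one_pos
  have hn0 : (0:ℝ) ≤ n := Nat.cast_nonneg n
  have hQ : 0 < n * (3 * K + 5) + 1 := by positivity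
  set d := min 1 (ρ / (2 * (n * (3 * K + 5) + 1))) with hd
  have hd0 : 0 < d := lt_min one_pos (by positivity)
  have hd1 : d ≤ 1 := min_le_left _ _
  have hdρ : n * (3 * K + 5) * d ≤ ρ / 2 := by
    have h1 : d ≤ ρ / (2 * (n * (3 * K + 5) + 1)) := min_le_right _ _
    rw [le_div_iff₀ (by positivity)] at h1
    nlinarith
  have hd2 : d ^ 2 ≤ 1 := by nlinarith
  have hd2p : 0 < d ^ 2 := by positivity
  obtain ⟨w₁, hw₁, hw₁p, hres₁⟩ := approx_resolvent hv hvp (d ^ 2 * 1) (by positivity) (d ^ 2) hd2p.le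
  let g : EE n → ℝ := fun x => b x (gradient w₁ x)
  have hgc : Continuous g := hbc.comp (continuous_id.prodMk (grad_cont hw₁))
  have hgp : ZnPeriodic g := by
    intro x k
    have h1 := grad_per hw₁p x k
    have h2 := hbp (gradient w₁ x) x k
    simp only [g, h1]
    exact h2
  obtain ⟨z, hz, hzp, hzg⟩ := approx_resolvent hgc hgp (κ / 10) (by positivity) 0 le_rfl
  simp only [zero_mul, sub_zero] at hzg
  obtain ⟨Z1, hZ10, hZ1⟩ := per_bdd (grad_cont hz) (grad_per hzp)
  obtain ⟨Z2, hZ20, hZ2⟩ := per_bdd (lap_cont hz) (lap_per hzp)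
  obtain ⟨m, hm0, hmd, hmZ1, hmZ2, hmK⟩ : ∃ m : ℝ, 0 < m ∧ m ≤ d ^ 2 ∧ m * Z1 ≤ ρ / 2 ∧
      m * Z2 ≤ κ / 10 ∧ m * (K + 1) ≤ κ := by
    have e1 : ∀ (c Q : ℝ), 0 ≤ Q → 0 < c → ∀ᶠ m in 𝓝[>] (0:ℝ), m * Q ≤ c := by
      intro c Q hQ hc
      have : Tendsto (fun m : ℝ => m * Q) (𝓝[>] 0) (𝓝 (0 * Q)) :=
        ((continuous_id.mul continuous_const).tendsto 0).mono_left nhdsWithin_le_nhds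
      rw [zero_mul] at this
      exact (this.eventually (gt_mem_nhds hc)).mono fun m hm => hm.le
    have : ∀ᶠ m in 𝓝[>] (0:ℝ), m ∈ Ioi (0:ℝ) := self_mem_nhdsWithin
    obtain ⟨m, h⟩ := (this.and ((e1 (d ^ 2) 1 zero_le_one hd2p).and ((e1 (ρ / 2) Z1 hZ10 (by positivity)).and
      ((e1 (κ / 10) Z2 hZ20 (by positivity)).and (e1 κ (K + 1) (by positivity) hκ))))).exists
    exact ⟨m, h.1, by simpa using h.2.1, h.2.2.1, h.2.2.2.1, h.2.2.2.2⟩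
  set θ := min 1 (κ / 10) with hθ
  have hθ0 : 0 < θ := lt_min one_pos (by positivity)
  have hθ1 : θ ≤ 1 := min_le_left _ _
  have hθκ : θ ≤ κ / 10 := min_le_right _ _
  obtain ⟨w, hw, hwp, hres⟩ := approx_resolvent hv hvp (m * θ) (by positivity) m hm0.le
  obtain ⟨hwv, hwl⟩ := key w m θ hw hwp hm0 hθ1 hres
  obtain ⟨hwv₁, hwl₁⟩ := key w₁ (d ^ 2) 1 hw₁ hw₁p hd2p le_rfl hres₁
  have hgw := gradR w m θ hw hwp hm0 (hmd.trans hd2) hθ1 hres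
  have hgw₁ := gradR w₁ (d ^ 2) 1 hw₁ hw₁p hd2p hd2 le_rfl hres₁
  have hdiff : ∀ x, ‖gradient w x - gradient w₁ x‖ ≤ ρ / 2 := by
    intro x
    rw [← grad_sub hw hw₁]
    refine (landau (hw.sub hw₁) (fun x k => ?_) (A := 2 * (K + 1) * d ^ 2) (B := 2 * (K + 2))
      (β := 2 * (K + 3)) (d := d) (fun x => ?_) (fun x => ?_) (by linarith) hd0 x).trans ?_
    · have h1 := hwp x k
      have h2 := hw₁p x k
      simp only [h1, h2]
    · have h1 := abs_le.1 (hwv x)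
      have h2 := abs_le.1 (hwv₁ x)
      have h3 : m * (K + 1) ≤ d ^ 2 * (K + 1) := by gcongr
      exact abs_le.2 ⟨by linarith, by linarith⟩
    · rw [lap_sub hw hw₁]
      have h1 := abs_le.1 (hwl x)
      have h2 := abs_le.1 (hwl₁ x)
      exact abs_le.2 ⟨by linarith, by linarith⟩
    · refine le_trans (le_of_eq ?_) hdρ
      field_simp; ring
  have hρ1 : ρ ≤ 1 := min_le_right _ _
  have hρρ : ρ ≤ ρ₀ := min_le_left _ _
  have hmz : ∀ x, ‖m • gradient z x‖ ≤ ρ / 2 := by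
    intro x
    rw [norm_smul, Real.norm_of_nonneg hm0.le]
    exact (mul_le_mul_of_nonneg_left (hZ1 x) hm0.le).trans hmZ1
  have hclose : ∀ x, |b x (gradient w x - m • gradient z x) - g x| ≤ κ / 10 := by
    intro x
    refine hunif x _ _ ?_ (by linarith [hgw₁ x]) ?_
    · refine (norm_sub_le _ _).trans ?_
      linarith [hgw x, hmz x]
    · rw [sub_right_comm]
      refine (norm_sub_le _ _).trans ?_
      linarith [hdiff x, hmz x]
  have hclose2 : ∀ x, |b x (gradient w x) - g x| ≤ κ / 10 := by
    intro x
    exact hunif x _ _ (by linarith [hgw x]) (by linarith [hgw₁ x]) (by linarith [hdiff x])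
  have hzl : ∀ x, m * |lap z x| ≤ κ / 10 := fun x =>
    (mul_le_mul_of_nonneg_left (hZ2 x) hm0.le).trans hmZ2
  have hup := res_step hv hvp hw hwp hz hzp hm0 hθκ hb1 hres hzg hzl
    (fun x => by linarith [(abs_le.1 (hclose x)).2])
  have hlow := res_step (v := fun y => - v y) (g := fun x => - g x)
    (b := fun x p => - b x (- p)) hv.neg (per_neg hvp) hw.neg (per_neg hwp) hz.neg (per_neg hzp) hm0 hθκ hb2'
    (neg_res hw hres)
    (fun x => by
      have := hzg x
      rw [← abs_neg] at this
      convert this using 2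
      simp; ring)
    (fun x => by
      rw [lap_neg hz, abs_neg]; exact hzl x)
    (fun x => by
      rw [grad_neg, grad_neg]
      have h1 : - (- gradient w x - m • - gradient z x) = gradient w x - m • gradient z x := by
        rw [smul_neg]; abel
      rw [h1]
      linarith [(abs_le.1 (hclose x)).1])
  refine ⟨w, hw, hwp, fun x => (hwv x).trans hmK, fun x => ?_⟩
  have h1 := hup x
  have h2 := hlow x
  rw [lap_neg hw] at h2
  have h3 := abs_le.1 (hclose2 x)
  exact abs_le.2 ⟨by linarith, by linarith⟩


lemma sqrt_lip {n : ℕ} {a : EE n → ℝ} (ha : ContDiff ℝ 2 a) (hp : ZnPeriodic a)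
    (hpos : ∀ x, 0 ≤ a x) : ∃ L, 0 ≤ L ∧ ∀ x y, |√(a x) - √(a y)| ≤ L * ‖x - y‖ := by
  have h1 : ContDiff ℝ 1 (fderiv ℝ a) := ha.fderiv_right (by norm_num)
  have hc2 : Continuous (fderiv ℝ (fderiv ℝ a)) := h1.continuous_fderiv (by norm_num)
  have hp1 : ZnPeriodic (fderiv ℝ a) := by
    intro x k
    rw [← fderiv_comp_add_right]
    congr 1
    funext y; exact hp y k
  have hp2 : ZnPeriodic (fderiv ℝ (fderiv ℝ a)) := by
    intro x k
    rw [← fderiv_comp_add_right]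
    congr 1
    funext y; exact hp1 y k
  obtain ⟨M, hM0, hM⟩ := per_bdd hc2 hp2
  have hd : ∀ x y, ‖fderiv ℝ a x - fderiv ℝ a y‖ ≤ M * ‖x - y‖ := fun x y =>
    convex_univ.norm_image_sub_le_of_norm_fderiv_le
      (fun z _ => (h1.differentiable (by norm_num)) z) (fun z _ => hM z) (mem_univ y) (mem_univ x)
  have hT : ∀ x y, |a x - a y - fderiv ℝ a y (x - y)| ≤ M * ‖x - y‖ ^ 2 := by
    intro x y
    have := (convex_closedBall y ‖x - y‖).norm_image_sub_le_of_norm_fderiv_le' (𝕜 := ℝ) (f := a)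
      (φ := fderiv ℝ a y) (C := M * ‖x - y‖)
      (fun z _ => cd_diff ha z) (fun z hz => (hd z y).trans (by
        gcongr
        simpa [dist_eq_norm] using hz)) (x := y) (y := x) (by simp)
      (by simp [dist_eq_norm])
    rw [Real.norm_eq_abs] at this
    linarith [this, sq ‖x - y‖, mul_assoc M ‖x - y‖ ‖x - y‖, congrArg (M * ·) (sq ‖x - y‖)]
  have hD : ∀ e y, fderiv ℝ a y e ≤ 2 * √M * √(a y) * ‖e‖ := by
    intro e y
    have hq : ∀ t : ℝ, 0 ≤ (M * ‖e‖ ^ 2) * (t * t) + fderiv ℝ a y e * t + a y := by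
      intro t
      have h := (abs_le.1 (hT (y + t • e) y)).2
      have h0 := hpos (y + t • e)
      rw [add_sub_cancel_left, map_smul, smul_eq_mul, norm_smul, mul_pow, Real.norm_eq_abs,
        sq_abs] at h
      nlinarith
    have hdis := discrim_le_zero hq
    rw [discrim] at hdis
    refine le_of_sq_le_sq ?_ (by positivity)
    rw [mul_pow, mul_pow, mul_pow, Real.sq_sqrt hM0, Real.sq_sqrt (hpos y)]
    nlinarith
  have hone : ∀ x y, √(a x) ≤ √(a y) + √M * ‖x - y‖ := by
    intro x y
    refine Real.sqrt_le_iff.2 ⟨by positivity, ?_⟩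
    have h := (abs_le.1 (hT x y)).2
    have h2 := hD (x - y) y
    have e1 := Real.sq_sqrt hM0
    have e2 := Real.sq_sqrt (hpos y)
    have : (√(a y) + √M * ‖x - y‖) ^ 2 =
      √(a y) ^ 2 + 2 * √M * √(a y) * ‖x - y‖ + √M ^ 2 * ‖x - y‖ ^ 2 := by ring
    rw [this, e1, e2]
    linarith
  refine ⟨√M, by positivity, fun x y => abs_le.2 ⟨?_, ?_⟩⟩
  · have := hone y x
    rw [norm_sub_rev] at this
    linarith
  · linarith [hone x y]

lemma H_lip {n : ℕ} {H : EE n → EE n → ℝ} {C₁ : ℝ}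
    (hH : ContDiff ℝ 2 fun q : EE n × EE n => H q.1 q.2)
    (hHper : ∀ p, ZnPeriodic fun x => H x p)
    (hDxH : ∀ x p, ‖fderiv ℝ (fun x' => H x' p) x‖ ≤ C₁ * (1 + |H x p|)) (R : ℝ) :
    ∃ L, 0 ≤ L ∧ ∀ x y p, ‖p‖ ≤ R → |H x p - H y p| ≤ L * ‖x - y‖ := by
  obtain ⟨M, hM0, hM⟩ := per_bdd_ball hH.continuous hHper R
  refine ⟨|C₁| * (1 + M), by positivity, fun x y p hp => ?_⟩
  have hdiff : Differentiable ℝ (fun x' => H x' p) := by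
    have : ContDiff ℝ 2 (fun x' => H x' p) :=
      hH.comp (contDiff_id.prodMk contDiff_const)
    exact cd_diff this
  exact convex_univ.norm_image_sub_le_of_norm_fderiv_le (𝕜 := ℝ) (f := fun x' => H x' p)
      (fun z _ => hdiff z) (fun z _ => (hDxH z p).trans (by
        have := hM z p hp
        gcongr
        exact le_abs_self _)) (mem_univ y) (mem_univ x)

lemma grad_zero {n : ℕ} {f : EE n → ℝ} {x : EE n} (h : IsLocalMax f x) : gradient f x = 0 := by
  unfold gradient
  rw [h.fderiv_eq_zero, map_zero]

lemma doubling {n : ℕ} {u w a : EE n → ℝ} {h : EE n → EE n → ℝ} {ε η κ κ' C L LH : ℝ}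
    (hu : Continuous u) (hup : ZnPeriodic u) (hw : ContDiff ℝ 2 w) (hwp : ZnPeriodic w)
    (hε : 0 < ε) (hη : 0 < η) (hC : 0 ≤ C) (hL0 : 0 ≤ L) (hLH0 : 0 ≤ LH) (hapos : ∀ x, 0 ≤ a x)
    (hsub : ∀ φ : EE n → ℝ, ContDiff ℝ 2 φ → ∀ x, IsLocalMax (fun y => u y - φ y) x →
      ε * u x + h x (gradient φ x) ≤ a x * lap φ x)
    (hsup : ∀ y, - κ ≤ ε * w y + h y (gradient w y) - (a y + η ^ 2) * lap w y)
    (hlip : ∀ x y, |w x - w y| ≤ C * ‖x - y‖ + κ') (hκ' : 4 * κ' ≤ η)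
    (hL : ∀ x y, |√(a x) - √(a y)| ≤ L * ‖x - y‖)
    (hLH : ∀ x y p, ‖p‖ ≤ 2 * C + 1 → |h x p - h y p| ≤ LH * ‖x - y‖) (x : EE n) :
    ε * (u x - w x) ≤ η * (LH * (2 * C + 1) + n * (2 * L ^ 2 * (2 * C + 1) ^ 2 + 2)) + κ := by
  set R := 2 * C + 1 with hR
  have hR1 : 1 ≤ R := by linarith
  obtain ⟨x0, k0, hk0, hmax0⟩ := per_max_prod (Y := EE n) (S := Metric.closedBall 0 (η * R))
      (isCompact_closedBall _ _) ⟨0, by simp; positivity⟩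
      (G := fun x k => u x - w (x - k) - 1 / (2 * η) * ‖k‖ ^ 2)
      (by have := hw.continuous; fun_prop) (fun k x z => by
        have h1 := hup x z
        have h2 := hwp (x - k) z
        simp only [h1]
        rw [← h2]
        congr 3
        abel)
  have hk0R : ‖k0‖ ≤ η * R := by simpa using hk0
  have hmax1 : ∀ x k, u x - w (x - k) - 1 / (2 * η) * ‖k‖ ^ 2 ≤
      u x0 - w (x0 - k0) - 1 / (2 * η) * ‖k0‖ ^ 2 := by
    intro x k
    by_cases hk : ‖k‖ ≤ η * R
    · exact hmax0 x k (by simpa using hk)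
    · push Not at hk
      have h1 := hmax0 x 0 (by simp; positivity)
      simp only [sub_zero, norm_zero] at h1
      have h2 := (abs_le.1 (hlip x (x - k))).2
      rw [sub_sub_cancel] at h2
      have h3 : C * ‖k‖ + κ' ≤ 1 / (2 * η) * ‖k‖ ^ 2 := by
        rw [one_div, inv_mul_eq_div, le_div_iff₀ (by positivity)]
        have h4 : η ≤ ‖k‖ := by nlinarith
        nlinarith
      have h5 : 1 / (2 * η) * (0 : ℝ) ^ 2 = 0 := by norm_num
      rw [h5] at h1
      linarith
  set y0 := x0 - k0 with hy0
  have hmax : ∀ x y, u x - w y - 1 / (2 * η) * ‖x - y‖ ^ 2 ≤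
      u x0 - w y0 - 1 / (2 * η) * ‖k0‖ ^ 2 := by
    intro x y
    have := hmax1 x (x - y)
    rwa [sub_sub_cancel] at this
  set p : EE n := η⁻¹ • k0 with hp
  have hpR : ‖p‖ ≤ R := by
    rw [hp, norm_smul, norm_inv, Real.norm_of_nonneg hη.le, inv_mul_le_iff₀ hη]
    exact hk0R
  have hN := contDiff_nsq (n := n)
  have hNa : ∀ (c : EE n) (s : ℝ), ContDiff ℝ 2 (fun y : EE n => ‖c + s • y‖ ^ 2) := fun c s =>
    hN.comp (contDiff_const.add (contDiff_id.const_smul s))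
  have hwa : ∀ (c : EE n) (s : ℝ), ContDiff ℝ 2 (fun y : EE n => w (c + s • y)) := fun c s => by
    fun_prop
  have gN : ∀ (c : EE n) (s : ℝ) (z : EE n),
      gradient (fun y : EE n => ‖c + s • y‖ ^ 2) z = s • (2 : ℝ) • (c + s • z) := fun c s z => by
    rw [grad_affine (f := fun y : EE n => ‖y‖ ^ 2) (cd_diff hN), grad_nsq]
  have lN : ∀ (c : EE n) (s : ℝ) (z : EE n),
      lap (fun y : EE n => ‖c + s • y‖ ^ 2) z = s ^ 2 * (2 * n) := fun c s z => by
    rw [lap_affine (f := fun y : EE n => ‖y‖ ^ 2) hN, lap_nsq]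
  -- variation in the second variable
  have hmy : IsLocalMax (fun y => (fun y => - w y) y -
      (fun y => 1 / (2 * η) * (fun y : EE n => ‖x0 + (-1 : ℝ) • y‖ ^ 2) y) y) y0 := by
    refine Eventually.of_forall fun y => ?_
    have := hmax x0 y
    have e1 : x0 + (-1 : ℝ) • y = x0 - y := by rw [neg_one_smul]; abel
    have e2 : x0 + (-1 : ℝ) • y0 = k0 := by rw [neg_one_smul, hy0]; abel
    simp only [e1, e2]
    linarith
  have hk0' : x0 + (-1 : ℝ) • y0 = k0 := by rw [neg_one_smul, hy0]; abel
  have hgw : gradient w y0 = p := by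
    have h0 := grad_zero hmy
    rw [grad_sub (hw.neg) (contDiff_const.mul (hNa _ _)), grad_neg, grad_mul (hNa _ _), gN,
      hk0'] at h0
    rw [hp]
    have e : (1 / (2 * η)) • (-1 : ℝ) • (2 : ℝ) • k0 = - (η⁻¹ • k0) := by
      rw [smul_smul, smul_smul, ← neg_smul]
      congr 1
      field_simp
    rw [e] at h0
    rw [sub_neg_eq_add] at h0
    exact (neg_add_eq_zero.1 h0)
  have hlw : - (n / η) ≤ lap w y0 := by
    have h0 := lap_nonpos_of_localMax (by
      exact (hw.neg).sub (contDiff_const.mul (hNa _ _))) hmy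
    rw [lap_sub (hw.neg) (contDiff_const.mul (hNa _ _)), lap_neg hw, lap_mul (hNa _ _), lN] at h0
    have e : 1 / (2 * η) * ((-1) ^ 2 * (2 * (n : ℝ))) = n / η := by field_simp
    rw [e] at h0
    linarith
  -- variation along a one-parameter family of directions
  have hs : ∀ s : ℝ, ε * u x0 + h x0 p ≤ a x0 * (s ^ 2 * lap w y0 + (1 - s) ^ 2 * (n / η)) := by
    intro s
    have c1 : (y0 - s • x0) + s • x0 = y0 := by abel
    have c2 : (s • x0 - y0) + (1 - s) • x0 = k0 := by
      rw [sub_smul, one_smul, hy0]; abel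
    have hφ1 := hwa (y0 - s • x0) s
    have hφ2 := hNa (s • x0 - y0) (1 - s)
    have hφ3 : ContDiff ℝ 2 (fun y => 1 / (2 * η) *
      (fun y : EE n => ‖(s • x0 - y0) + (1 - s) • y‖ ^ 2) y) := contDiff_const.mul hφ2
    have := hsub (fun y => (fun y => w ((y0 - s • x0) + s • y)) y + (fun y => 1 / (2 * η) *
      (fun y : EE n => ‖(s • x0 - y0) + (1 - s) • y‖ ^ 2) y) y) (hφ1.add hφ3) x0 (by
        refine Eventually.of_forall fun z => ?_
        have hz := hmax z ((y0 - s • x0) + s • z)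
        have e1 : z - ((y0 - s • x0) + s • z) = (s • x0 - y0) + (1 - s) • z := by
          rw [sub_smul, one_smul]; abel
        rw [e1] at hz
        simp only [c1, c2]
        linarith)
    rw [grad_add hφ1 hφ3, lap_add hφ1 hφ3, grad_affine (cd_diff hw), lap_affine hw,
      grad_mul hφ2, lap_mul hφ2, gN, lN, c1, c2, hgw] at this
    have e : s • p + (1 / (2 * η)) • (1 - s) • (2 : ℝ) • k0 = p := by
      rw [hp, smul_smul, smul_smul, smul_smul, ← add_smul]
      congr 1
      field_simp
      ring
    have e' : 1 / (2 * η) * ((1 - s) ^ 2 * (2 * (n : ℝ))) = (1 - s) ^ 2 * (n / η) := by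
      field_simp
    rw [e, e'] at this
    exact this
  set α := √(a x0) with hα
  set β := √(a y0 + η ^ 2) with hβ
  have hα2 : α ^ 2 = a x0 := Real.sq_sqrt (hapos _)
  have hβ2 : β ^ 2 = a y0 + η ^ 2 := Real.sq_sqrt (by have := hapos y0; positivity)
  have hnη : 0 ≤ (n : ℝ) / η := by positivity
  have hkey : ε * u x0 + h x0 p ≤ β ^ 2 * lap w y0 + (α - β) ^ 2 * (n / η) := by
    rcases (Real.sqrt_nonneg (a x0)).eq_or_lt with h0 | h0
    · have hα0 : α = 0 := h0.symm
      have := hs 0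
      rw [← hα2, hα0] at this
      rw [hα0]
      nlinarith [sq_nonneg β]
    · have hα0 : α ≠ 0 := h0.ne'
      have := hs (β / α)
      rw [← hα2] at this
      have e : α ^ 2 * ((β / α) ^ 2 * lap w y0 + (1 - β / α) ^ 2 * (n / η)) =
          β ^ 2 * lap w y0 + (α - β) ^ 2 * (n / η) := by
        field_simp
      rwa [e] at this
  have hxy : ‖x0 - y0‖ = ‖k0‖ := by rw [hy0, sub_sub_cancel]
  have hαβ : |α - β| ≤ L * (η * R) + η := by
    have h1 := hL x0 y0
    rw [hxy] at h1
    have h2 : L * ‖k0‖ ≤ L * (η * R) := by gcongr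
    have h3 : √(a y0) ≤ β := Real.sqrt_le_sqrt (by nlinarith)
    have h4 : β ≤ √(a y0) + η := by
      refine Real.sqrt_le_iff.2 ⟨by positivity, ?_⟩
      have := Real.sq_sqrt (hapos y0)
      have := Real.sqrt_nonneg (a y0)
      nlinarith
    have h5 := abs_le.1 h1
    exact abs_le.2 ⟨by linarith, by linarith⟩
  have hsq : (α - β) ^ 2 * (n / η) ≤ η * (n * (2 * L ^ 2 * R ^ 2 + 2)) := by
    have h1 : (α - β) ^ 2 ≤ η ^ 2 * (2 * L ^ 2 * R ^ 2 + 2) := by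
      rw [← sq_abs]
      calc |α - β| ^ 2 ≤ (L * (η * R) + η) ^ 2 := by gcongr
        _ ≤ _ := by nlinarith [sq_nonneg (L * (η * R) - η)]
    calc (α - β) ^ 2 * (n / η) ≤ η ^ 2 * (2 * L ^ 2 * R ^ 2 + 2) * (n / η) := by gcongr
      _ = _ := by field_simp
  have hh : h y0 p - h x0 p ≤ η * (LH * R) := by
    have h1 := (abs_le.1 (hLH x0 y0 p hpR)).1
    rw [hxy] at h1
    have h2 : LH * ‖k0‖ ≤ LH * (η * R) := by gcongr
    linarith
  have hsu := hsup y0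
  rw [hgw, ← hβ2] at hsu
  have hfin : u x - w x ≤ u x0 - w y0 := by
    have h1 := hmax x x
    have h2 : 0 ≤ 1 / (2 * η) * ‖k0‖ ^ 2 := by positivity
    simp only [sub_self, norm_zero] at h1
    norm_num at h1 h2
    linarith
  have : ε * (u x - w x) ≤ ε * (u x0 - w y0) := by gcongr
  linarith

/-- Lemma 2.1: vanishing viscosity rate
`‖u^{ε,η} − u^ε‖_∞ ≤ C η / ε` for the discounted problems. -/
theorem vanishing_viscosity_rate {n : ℕ}
    (H : EuclideanSpace ℝ (Fin n) → EuclideanSpace ℝ (Fin n) → ℝ)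
    (hH : ContDiff ℝ 2 fun q : EuclideanSpace ℝ (Fin n) × EuclideanSpace ℝ (Fin n) =>
      H q.1 q.2)
    (hHper : ∀ p, ZnPeriodic fun x => H x p)
    (hconv : ∀ x, ConvexOn ℝ Set.univ (H x))
    (hsuper : ∀ A : ℝ, ∃ R : ℝ, ∀ x p, R ≤ ‖p‖ → A * ‖p‖ ≤ H x p)
    (C₁ : ℝ)
    (hDxH : ∀ x p, ‖fderiv ℝ (fun x' => H x' p) x‖ ≤ C₁ * (1 + |H x p|))
    (a : EuclideanSpace ℝ (Fin n) → ℝ)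
    (ha : ContDiff ℝ 2 a) (haper : ZnPeriodic a) (hapos : ∀ x, 0 ≤ a x)
    (u : ℝ → EuclideanSpace ℝ (Fin n) → ℝ)
    (v : ℝ → ℝ → EuclideanSpace ℝ (Fin n) → ℝ)
    (C₀ : ℝ) (hC₀ : 0 < C₀)
    (hu : ∀ ε : ℝ, 0 < ε → Continuous (u ε) ∧ ZnPeriodic (u ε) ∧
      IsViscSolution (fun x r p m => ε * r + H x p - a x * m) (u ε))
    (hv : ∀ ε η : ℝ, 0 < ε → 0 < η → Continuous (v ε η) ∧ ZnPeriodic (v ε η) ∧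
      IsViscSolution (fun x r p m => ε * r + H x p - (a x + η ^ 2) * m) (v ε η))
    (hvlip : ∀ ε η : ℝ, 0 < ε → 0 < η → LipschitzWith (Real.toNNReal C₀) (v ε η))
    (hvsemi : ∀ ε η : ℝ, 0 < ε → 0 < η →
      ∀ φ : EuclideanSpace ℝ (Fin n) → ℝ, ContDiff ℝ 2 φ →
        ∀ x, IsLocalMin (fun y => v ε η y - φ y) x → lap φ x ≤ C₀) :
    ∃ C > 0, ∀ ε η : ℝ, 0 < ε → 0 < η →
      ∀ x, |v ε η x - u ε x| ≤ C * η / ε := by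
  obtain ⟨L, hL0, hL⟩ := sqrt_lip ha haper hapos
  obtain ⟨LH, hLH0, hLH⟩ := H_lip hH hHper hDxH (2 * C₀ + 1)
  obtain ⟨Ma, hMa0, hMa⟩ := per_bdd ha.continuous haper
  obtain ⟨R0, hR0⟩ := hsuper 0
  obtain ⟨MH, hMH0, hMH⟩ := per_bdd_ball hH.continuous hHper R0
  have hHlow : ∀ x p, - MH ≤ H x p := by
    intro x p
    rcases le_total R0 ‖p‖ with h | h
    · have := hR0 x p h
      linarith
    · exact (abs_le.1 (hMH x p h)).1
  set D : ℝ := LH * (2 * C₀ + 1) + n * (2 * L ^ 2 * (2 * C₀ + 1) ^ 2 + 2) with hD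
  have hD0 : 0 ≤ D := by positivity
  refine ⟨D + 1, by linarith, fun ε η hε hη x => ?_⟩
  obtain ⟨huc, hup, husub, husup⟩ := hu ε hε
  obtain ⟨hvc, hvp, hvsub, hvsup⟩ := hv ε η hε hη
  have hlipv : ∀ x y, |v ε η x - v ε η y| ≤ C₀ * ‖x - y‖ := by
    intro x y
    have := (hvlip ε η hε hη).norm_sub_le x y
    rwa [Real.coe_toNNReal _ hC₀.le] at this
  have hden : ∀ x, 0 < a x + η ^ 2 := fun x => by have := hapos x; positivity
  obtain ⟨Mv, hMv0, hMv⟩ := per_bdd hvc hvp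
  have hblow : ∀ x p, - (C₀ + (ε * Mv + MH) / η ^ 2) ≤ (ε * v ε η x + H x p) / (a x + η ^ 2) := by
    intro x p
    have h1 : - (ε * Mv + MH) ≤ ε * v ε η x + H x p := by
      have h2 := (abs_le.1 (hMv x)).1
      have h3 := hHlow x p
      nlinarith
    have h4 : (ε * Mv + MH) / (a x + η ^ 2) ≤ (ε * Mv + MH) / η ^ 2 := by
      have := hapos x
      gcongr
      linarith
    have h5 : - ((ε * Mv + MH) / (a x + η ^ 2)) ≤ (ε * v ε η x + H x p) / (a x + η ^ 2) := by
      rw [← neg_div]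
      have := (hden x).le
      gcongr
    linarith
  have hb2 : ∀ φ : EE n → ℝ, ContDiff ℝ 2 φ → ∀ x, IsLocalMax (fun y => v ε η y - φ y) x →
      (fun x p => (ε * v ε η x + H x p) / (a x + η ^ 2)) x (gradient φ x) ≤ lap φ x := by
    intro φ hφ x hx
    have := hvsub φ hφ x hx
    simp only at this ⊢
    rw [div_le_iff₀ (hden x)]
    linarith
  have hmain : ∀ τ : ℝ, 0 < τ → ε * |v ε η x - u ε x| ≤ η * D + τ := by
    intro τ hτ
    have hS : 0 < 2 * ε + Ma + η ^ 2 := by positivity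
    obtain ⟨κ, hκ0, hκ1, hκ2⟩ : ∃ κ : ℝ, 0 < κ ∧ 8 * κ ≤ η ∧ κ * (2 * ε + Ma + η ^ 2) ≤ τ := by
      refine ⟨min (η / 8) (τ / (2 * ε + Ma + η ^ 2)), by positivity, ?_, ?_⟩
      · have := min_le_left (η / 8) (τ / (2 * ε + Ma + η ^ 2))
        linarith
      · rw [← le_div_iff₀ hS]
        exact min_le_right _ _
    obtain ⟨w, hw, hwp, hwv, hwl⟩ := regularize (v := v ε η)
      (b := fun x p => (ε * v ε η x + H x p) / (a x + η ^ 2))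
      (K := C₀ + (ε * Mv + MH) / η ^ 2) (κ := κ) hvc hvp (by positivity) hκ0
      (by
        have h1 := hH.continuous
        have h2 := ha.continuous
        exact Continuous.div (by fun_prop) (by fun_prop) (fun q => (hden q.1).ne'))
      (by
        intro p z k
        have h1 := hvp z k
        have h2 := haper z k
        have h3 := hHper p z k
        simp only at h3
        simp only [h1, h2, h3])
      (by
        intro φ hφ x hx
        have := hvsup φ hφ x hx
        simp only at this ⊢
        rw [le_div_iff₀ (hden x)]
        linarith)
      hb2
      (by
        intro φ hφ x hx
        have := hvsemi ε η hε hη φ hφ x hx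
        have h2 : 0 ≤ (ε * Mv + MH) / η ^ 2 := by positivity
        linarith)
      (fun φ hφ x hx => (hblow x _).trans (hb2 φ hφ x hx))
    have hres : ∀ y, |ε * w y + H y (gradient w y) - (a y + η ^ 2) * lap w y| ≤
        κ * (ε + Ma + η ^ 2) := by
      intro y
      have e : ε * w y + H y (gradient w y) - (a y + η ^ 2) * lap w y =
          ε * (w y - v ε η y) - (a y + η ^ 2) *
            (lap w y - (ε * v ε η y + H y (gradient w y)) / (a y + η ^ 2)) := by
        have := (hden y).ne'
        field_simp
        ring
      rw [e]
      have h1 := hwv y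
      have h2 := hwl y
      have h3 : a y ≤ Ma := (le_abs_self _).trans (hMa y)
      refine (abs_sub _ _).trans ?_
      rw [abs_mul, abs_mul, abs_of_pos hε, abs_of_pos (hden y)]
      calc _ ≤ ε * κ + (Ma + η ^ 2) * κ := by
            have := (hden y).le
            gcongr
        _ = _ := by ring
    have hwlip : ∀ x y, |w x - w y| ≤ C₀ * ‖x - y‖ + 2 * κ := by
      intro x y
      have h1 := abs_le.1 (hwv x)
      have h2 := abs_le.1 (hwv y)
      have h3 := abs_le.1 (hlipv x y)
      exact abs_le.2 ⟨by linarith, by linarith⟩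
    have d1 := doubling (u := u ε) (w := w) (a := a) (h := H) huc hup hw hwp hε hη hC₀.le hL0 hLH0
      hapos (fun φ hφ x hx => by
        have := husub φ hφ x hx
        simp only at this
        linarith) (fun y => (abs_le.1 (hres y)).1) hwlip (by linarith) hL hLH x
    have d2 := doubling (u := fun y => - u ε y) (w := fun y => - w y) (a := a)
      (h := fun x p => - H x (- p)) (κ := κ * (ε + Ma + η ^ 2)) (κ' := 2 * κ) (C := C₀) (LH := LH)
      huc.neg (per_neg hup) hw.neg (per_neg hwp) hε hη hC₀.le hL0 hLH0
      hapos (fun φ hφ x hx => by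
        have hx' : IsLocalMin (fun y => u ε y - (fun y => - φ y) y) x := by
          refine hx.neg.congr (Eventually.of_forall fun y => ?_)
          simp; ring
        have := husup _ hφ.neg x hx'
        rw [grad_neg, lap_neg hφ] at this
        simp only at this
        linarith) (fun y => by
          rw [grad_neg, lap_neg hw, neg_neg]
          have := (abs_le.1 (hres y)).2
          linarith) (fun x y => by
          have := hwlip y x
          rw [norm_sub_rev] at this
          convert this using 2
          ring) (by linarith) hL (fun x y p hp => by
          have := hLH y x (-p) (by rwa [norm_neg])
          rw [norm_sub_rev] at this
          convert this using 2
          ring) x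
    rw [← hD] at d1 d2
    have h1 := abs_le.1 (hwv x)
    rw [← abs_of_pos hε, ← abs_mul, abs_of_pos hε]
    refine abs_le.2 ⟨?_, ?_⟩ <;> nlinarith
  have h := le_of_forall_pos_le_add hmain
  rw [le_div_iff₀ hε]
  nlinarith

end
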